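/- Let $d,m,n\ge 1$, and let $\phi:\mathbb R\to\mathbb R$ be twice differentiable with $|\phi|\le B_\phi$, $|\phi'|\le B_{\phi'}$ and $|\phi''|\le B_{\phi''}$ everywhere. Fix $u\in\{\pm 1/\sqrt m\}^m$ and, for $W\in\mathbb R^{d\times m}$ with columns $W_1,\dots,W_m\in\mathbb R^d$, put $f_W(x)=\sum_{k=1}^m u_k\,\phi(\langle W_k,x\rangle)$. For a sample $S=((x_i,y_i))_{i=1}^n$ with $x_i\in\mathbb R^d$, $\|x_i\|_2\le C_x$ and $y_i\in\mathbb R$, $|y_i|\le C_y$, let $$\mathcal L_S(W)=\frac1n\sum_{i=1}^n\frac12\,(f_W(x_i)-y_i)^2 .$$ Fix $W,\widetilde W\in\mathbb R^{d\times m}$ and $C_0>0$ with $\mathcal L_S(\widetilde W)\le C_0^2$. Then $\mathcal L_S$ is twice differentiable on $\mathbb R^{d\times m}\cong\mathbb R^{dm}$ with symmetric Hessian $\nabla^2\mathcal L_S$, $$\lambda_{\max}\big(\nabla^2\mathcal L_S(W)\big)\le C_x^2\Big(B_{\phi'}^2+B_{\phi''}B_\phi+\frac{B_{\phi''}C_y}{\sqrt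 m}\Big),$$ and for every $\alpha\in[0,1]$ $$\lambda_{\min}\big(\nabla^2\mathcal L_S(\widetilde W+\alpha(W-\widetilde W))\big)\ \ge\ -\frac{C_x^2B_{\phi''}\big(B_{\phi'}C_x+\sqrt2\,C_0\big)}{\sqrt m}\cdot\max\big(1,\|W-\widetilde W\|_F\big),$$ where $\lambda_{\max}$ and $\lambda_{\min}$ denote the largest and smallest eigenvalue. -/

import Mathlib

noncomputable section

/-- Weight matrices `W ∈ ℝ^{d×m}`, vectorised; `W (j, k)` is the entry in row `j` and column `k`,
and the Euclidean norm is the Frobenius norm of the matrix. -/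
abbrev Param (d m : ℕ) : Type := EuclideanSpace ℝ (Fin d × Fin m)

/-- Inputs live in `ℝ^d` with the Euclidean norm. -/
abbrev Input (d : ℕ) : Type := EuclideanSpace ℝ (Fin d)

/-- Shallow network `f_W(x) = ∑ₖ uₖ φ(⟨Wₖ, x⟩)`, where `Wₖ` is the `k`-th column of `W`. -/
def nnet {d m : ℕ} (φ : ℝ → ℝ) (u : Fin m → ℝ) (W : Param d m) (x : Input d) : ℝ :=
  ∑ k : Fin m, u k * φ (∑ j : Fin d, W (j, k) * x j)

/-- Squared loss `ℓ(W, (x, y)) = (1/2) (f_W(x) − y)²`. -/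
def sqLoss {d m : ℕ} (φ : ℝ → ℝ) (u : Fin m → ℝ) (W : Param d m) (z : Input d × ℝ) : ℝ :=
  (1 / 2) * (nnet φ u W z.1 - z.2) ^ 2

/-- Empirical risk `L_S(W) = (1/n) ∑ᵢ ℓ(W, zᵢ)`. -/
def empRisk {d m n : ℕ} (φ : ℝ → ℝ) (u : Fin m → ℝ) (S : Fin n → Input d × ℝ)
    (W : Param d m) : ℝ :=
  (1 / (n : ℝ)) * ∑ i : Fin n, sqLoss φ u W (S i)

/-- The Hessian matrix `∇²L(W)` of a function of the `dm` weights: its `(p, q)` entry is the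
second derivative of `L` at `W` in the coordinate directions `p` and `q`. -/
def hessian {d m : ℕ} (L : Param d m → ℝ) (W : Param d m) :
    Matrix (Fin d × Fin m) (Fin d × Fin m) ℝ :=
  Matrix.of fun p q =>
    fderiv ℝ (fderiv ℝ L) W (EuclideanSpace.single p 1) (EuclideanSpace.single q 1)

/-- The set of real eigenvalues of a square real matrix. For a symmetric matrix of positive size
it is finite and nonempty. -/
def eigenvalueSet {ι : Type*} [Fintype ι] [DecidableEq ι] (A : Matrix ι ι ℝ) : Set ℝ :=
  {μ : ℝ | Module.End.HasEigenvalue (Matrix.toLin' A) μ}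

/-- The smallest eigenvalue of a symmetric matrix. -/
def lambdaMin {ι : Type*} [Fintype ι] [DecidableEq ι] (A : Matrix ι ι ℝ) : ℝ :=
  sInf (eigenvalueSet A)

/-- The largest eigenvalue of a symmetric matrix. -/
def lambdaMax {ι : Type*} [Fintype ι] [DecidableEq ι] (A : Matrix ι ι ℝ) : ℝ :=
  sSup (eigenvalueSet A)

end

open Finset

section Eigenvalues

variable {ι : Type*} [Fintype ι] [DecidableEq ι]

/-- A symmetric real matrix of positive size has a real eigenvalue. -/
theorem eigenvalueSet_nonempty [Nonempty ι] {A : Matrix ι ι ℝ} (hA : A.IsSymm) :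
    (eigenvalueSet A).Nonempty := by
  have hH : A.IsHermitian := by
    rw [Matrix.IsHermitian, Matrix.conjTranspose_eq_transpose_of_trivial]; exact hA
  obtain ⟨i⟩ := ‹Nonempty ι›
  refine ⟨hH.eigenvalues i,
    Module.End.hasEigenvalue_of_hasEigenvector (x := ⇑(hH.eigenvectorBasis i)) ⟨?_, ?_⟩⟩
  · rw [Module.End.mem_eigenspace_iff, Matrix.toLin'_apply]
    exact hH.mulVec_eigenvectorBasis i
  · intro h
    apply hH.eigenvectorBasis.orthonormal.ne_zero i
    ext j
    exact congrFun h j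

/-- Every eigenvalue is the Rayleigh quotient of some nonzero vector. -/
theorem exists_dotProduct_mulVec_eq {A : Matrix ι ι ℝ} {μ : ℝ} (hμ : μ ∈ eigenvalueSet A) :
    ∃ v : ι → ℝ, 0 < ∑ p, v p ^ 2 ∧ ∑ p, v p * ∑ q, A p q * v q = μ * ∑ p, v p ^ 2 := by
  obtain ⟨v, hv⟩ := Module.End.HasEigenvalue.exists_hasEigenvector hμ
  have happ := hv.apply_eq_smul
  rw [Matrix.toLin'_apply] at happ
  refine ⟨v, ?_, ?_⟩
  · obtain ⟨p, hp⟩ := Function.ne_iff.mp hv.2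
    exact sum_pos' (fun _ _ => sq_nonneg _) ⟨p, mem_univ _, by positivity [show v p ≠ 0 from hp]⟩
  · rw [mul_sum]
    refine sum_congr rfl fun p _ => ?_
    have hp : ∑ q, A p q * v q = μ * v p := congrFun happ p
    rw [hp]; ring

theorem lambdaMax_le [Nonempty ι] {A : Matrix ι ι ℝ} (hA : A.IsSymm) {c : ℝ}
    (h : ∀ v : ι → ℝ, ∑ p, v p * ∑ q, A p q * v q ≤ c * ∑ p, v p ^ 2) : lambdaMax A ≤ c := by
  refine csSup_le (eigenvalueSet_nonempty hA) fun μ hμ => ?_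
  obtain ⟨v, hv, hμv⟩ := exists_dotProduct_mulVec_eq hμ
  exact le_of_mul_le_mul_right (hμv ▸ h v) hv

theorem le_lambdaMin [Nonempty ι] {A : Matrix ι ι ℝ} (hA : A.IsSymm) {c : ℝ}
    (h : ∀ v : ι → ℝ, c * ∑ p, v p ^ 2 ≤ ∑ p, v p * ∑ q, A p q * v q) : c ≤ lambdaMin A := by
  refine le_csInf (eigenvalueSet_nonempty hA) fun μ hμ => ?_
  obtain ⟨v, hv, hμv⟩ := exists_dotProduct_mulVec_eq hμ
  exact le_of_mul_le_mul_right (hμv ▸ h v) hv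

end Eigenvalues

section Derivatives

variable {d m n : ℕ}

/-- The quadratic form of the Hessian matrix is the second derivative on the diagonal. -/
theorem sum_mul_hessian_mul (L : Param d m → ℝ) (W : Param d m) (v : Fin d × Fin m → ℝ) :
    ∑ p, v p * ∑ q, hessian L W p q * v q =
      fderiv ℝ (fderiv ℝ L) W (WithLp.toLp 2 v) (WithLp.toLp 2 v) := by
  have hv : (WithLp.toLp 2 v : Param d m) = ∑ p, v p • EuclideanSpace.single p (1 : ℝ) := by
    ext q
    simp [Pi.single_apply]
  rw [hv]
  simp only [map_sum, map_smul, _root_.sum_apply, _root_.smul_apply,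
    smul_eq_mul, hessian, Matrix.of_apply]
  simp only [mul_sum]
  rw [sum_comm]
  refine sum_congr rfl fun p _ => sum_congr rfl fun q _ => ?_
  ring

/-- The pre-activation `W ↦ ⟨W_k, x⟩` of the `k`-th neuron, as a continuous linear functional. -/
noncomputable def preact (x : Input d) (k : Fin m) : Param d m →L[ℝ] ℝ :=
  ∑ j : Fin d, x j • EuclideanSpace.proj (j, k)

theorem preact_apply (x : Input d) (k : Fin m) (W : Param d m) :
    preact x k W = ∑ j : Fin d, W (j, k) * x j := by
  simp [preact, mul_comm]

theorem nnet_eq (φ : ℝ → ℝ) (u : Fin m → ℝ) (W : Param d m) (x : Input d) :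
    nnet φ u W x = ∑ k, u k * φ (preact x k W) := by
  simp [nnet, preact_apply]

/-- The gradient of the network output with respect to the weights. -/
noncomputable def nnetGrad (φ : ℝ → ℝ) (u : Fin m → ℝ) (x : Input d) (W : Param d m) :
    Param d m →L[ℝ] ℝ :=
  ∑ k, (u k * deriv φ (preact x k W)) • preact x k

/-- The second derivative of the network output with respect to the weights. -/
noncomputable def nnetHess (φ : ℝ → ℝ) (u : Fin m → ℝ) (x : Input d) (W : Param d m) :
    Param d m →L[ℝ] Param d m →L[ℝ] ℝ :=
  ∑ k, ((u k * deriv (deriv φ) (preact x k W)) • preact x k).smulRight (preact x k)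

theorem hasFDerivAt_nnet {φ : ℝ → ℝ} (hφ : Differentiable ℝ φ) (u : Fin m → ℝ) (x : Input d)
    (W : Param d m) : HasFDerivAt (fun V => nnet φ u V x) (nnetGrad φ u x W) W := by
  simp only [nnet_eq, nnetGrad]
  refine HasFDerivAt.fun_sum fun k _ => ?_
  have h := ((hφ (preact x k W)).hasDerivAt.comp_hasFDerivAt W
    (preact x k).hasFDerivAt).const_mul (u k)
  rw [smul_smul] at h
  exact h

theorem hasFDerivAt_nnetGrad {φ : ℝ → ℝ} (hφ' : Differentiable ℝ (deriv φ)) (u : Fin m → ℝ)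
    (x : Input d) (W : Param d m) :
    HasFDerivAt (nnetGrad φ u x) (nnetHess φ u x W) W := by
  unfold nnetGrad nnetHess
  refine HasFDerivAt.fun_sum fun k _ => ?_
  have h := ((hφ' (preact x k W)).hasDerivAt.comp_hasFDerivAt W
    (preact x k).hasFDerivAt).const_mul (u k)
  rw [smul_smul] at h
  exact h.smul_const (preact x k)

/-- The first derivative of the empirical risk. -/
noncomputable def riskGrad (φ : ℝ → ℝ) (u : Fin m → ℝ) (S : Fin n → Input d × ℝ)
    (W : Param d m) : Param d m →L[ℝ] ℝ :=
  (1 / (n : ℝ)) • ∑ i, (nnet φ u W (S i).1 - (S i).2) • nnetGrad φ u (S i).1 W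

/-- The second derivative of the empirical risk. -/
noncomputable def riskHess (φ : ℝ → ℝ) (u : Fin m → ℝ) (S : Fin n → Input d × ℝ)
    (W : Param d m) : Param d m →L[ℝ] Param d m →L[ℝ] ℝ :=
  (1 / (n : ℝ)) • ∑ i, ((nnet φ u W (S i).1 - (S i).2) • nnetHess φ u (S i).1 W +
    (nnetGrad φ u (S i).1 W).smulRight (nnetGrad φ u (S i).1 W))

theorem hasFDerivAt_empRisk {φ : ℝ → ℝ} (hφ : Differentiable ℝ φ) (u : Fin m → ℝ)
    (S : Fin n → Input d × ℝ) (W : Param d m) :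
    HasFDerivAt (empRisk φ u S) (riskGrad φ u S W) W := by
  unfold empRisk riskGrad
  refine HasFDerivAt.const_mul (HasFDerivAt.fun_sum fun i _ => ?_) _
  unfold sqLoss
  have h := (((hasFDerivAt_nnet hφ u (S i).1 W).sub_const (S i).2).pow 2).const_mul (1 / 2)
  refine h.congr_fderiv ?_
  rw [smul_smul]
  congr 1
  norm_num
  ring

theorem hasFDerivAt_riskGrad {φ : ℝ → ℝ} (hφ : Differentiable ℝ φ)
    (hφ' : Differentiable ℝ (deriv φ)) (u : Fin m → ℝ)
    (S : Fin n → Input d × ℝ) (W : Param d m) :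
    HasFDerivAt (riskGrad φ u S) (riskHess φ u S W) W := by
  unfold riskGrad riskHess
  refine (HasFDerivAt.fun_sum fun i _ => ?_).fun_const_smul (1 / (n : ℝ))
  exact ((hasFDerivAt_nnet hφ u (S i).1 W).sub_const (S i).2).smul
    (hasFDerivAt_nnetGrad hφ' u (S i).1 W)

theorem fderiv_empRisk {φ : ℝ → ℝ} (hφ : Differentiable ℝ φ) (u : Fin m → ℝ)
    (S : Fin n → Input d × ℝ) :
    fderiv ℝ (empRisk φ u S : Param d m → ℝ) = riskGrad φ u S :=
  funext fun W => (hasFDerivAt_empRisk hφ u S W).fderiv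

theorem fderiv_fderiv_empRisk {φ : ℝ → ℝ} (hφ : Differentiable ℝ φ)
    (hφ' : Differentiable ℝ (deriv φ)) (u : Fin m → ℝ)
    (S : Fin n → Input d × ℝ) (W : Param d m) :
    fderiv ℝ (fderiv ℝ (empRisk φ u S : Param d m → ℝ)) W = riskHess φ u S W := by
  rw [fderiv_empRisk hφ]
  exact (hasFDerivAt_riskGrad hφ hφ' u S W).fderiv

theorem nnetGrad_apply (φ : ℝ → ℝ) (u : Fin m → ℝ) (x : Input d) (W D : Param d m) :
    nnetGrad φ u x W D = ∑ k, u k * deriv φ (preact x k W) * preact x k D := by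
  simp [nnetGrad]

theorem nnetHess_apply (φ : ℝ → ℝ) (u : Fin m → ℝ) (x : Input d) (W D E : Param d m) :
    nnetHess φ u x W D E =
      ∑ k, u k * deriv (deriv φ) (preact x k W) * preact x k D * preact x k E := by
  simp [nnetHess]

theorem riskHess_apply (φ : ℝ → ℝ) (u : Fin m → ℝ) (S : Fin n → Input d × ℝ)
    (W D E : Param d m) :
    riskHess φ u S W D E = (1 / (n : ℝ)) * ∑ i,
      ((nnet φ u W (S i).1 - (S i).2) * nnetHess φ u (S i).1 W D E +
        nnetGrad φ u (S i).1 W D * nnetGrad φ u (S i).1 W E) := by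
  simp [riskHess]

theorem isSymm_hessian_empRisk {φ : ℝ → ℝ} (hφ : Differentiable ℝ φ)
    (hφ' : Differentiable ℝ (deriv φ)) (u : Fin m → ℝ)
    (S : Fin n → Input d × ℝ) (W : Param d m) :
    (hessian (empRisk φ u S) W).IsSymm := by
  ext p q
  simp only [Matrix.transpose_apply, hessian, Matrix.of_apply, fderiv_fderiv_empRisk hφ hφ',
    riskHess_apply, nnetHess_apply]
  congr 1
  refine sum_congr rfl fun i _ => ?_
  rw [mul_comm (nnetGrad _ _ _ _ _)]
  congr 2
  exact sum_congr rfl fun k _ => by ring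

end Derivatives

section Bounds

variable {d m n : ℕ}

theorem sum_preact_sq_le (x : Input d) (D : Param d m) :
    ∑ k, preact x k D ^ 2 ≤ ‖x‖ ^ 2 * ‖D‖ ^ 2 := by
  have hD : ‖D‖ ^ 2 = ∑ k : Fin m, ∑ j : Fin d, D (j, k) ^ 2 := by
    rw [EuclideanSpace.real_norm_sq_eq, Fintype.sum_prod_type_right]
  rw [hD, mul_sum, EuclideanSpace.real_norm_sq_eq]
  refine sum_le_sum fun k _ => ?_
  rw [preact_apply, mul_comm]
  exact sum_mul_sq_le_sq_mul_sq _ _ _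

/-- A sum `∑ uₖ tₖ` with `‖u‖ ≤ 1` and `|tₖ| ≤ B |⟨Dₖ, x⟩|` is at most `B ‖x‖ ‖D‖`. -/
theorem sq_sum_mul_le_of_abs_le {u : Fin m → ℝ} (hu : ∑ k, u k ^ 2 ≤ 1) {B : ℝ} (x : Input d)
    (D : Param d m) {t : Fin m → ℝ} (ht : ∀ k, |t k| ≤ B * |preact x k D|) :
    (∑ k, u k * t k) ^ 2 ≤ B ^ 2 * (‖x‖ ^ 2 * ‖D‖ ^ 2) := by
  have h1 : ∑ k, t k ^ 2 ≤ B ^ 2 * (‖x‖ ^ 2 * ‖D‖ ^ 2) := calc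
    ∑ k, t k ^ 2 ≤ ∑ k, B ^ 2 * preact x k D ^ 2 := by
      refine sum_le_sum fun k _ => ?_
      rw [← sq_abs (t k), ← sq_abs (preact x k D), ← mul_pow]
      exact pow_le_pow_left₀ (abs_nonneg _) (ht k) 2
    _ ≤ _ := by
      rw [← mul_sum]
      exact mul_le_mul_of_nonneg_left (sum_preact_sq_le x D) (sq_nonneg _)
  calc (∑ k, u k * t k) ^ 2 ≤ (∑ k, u k ^ 2) * ∑ k, t k ^ 2 := sum_mul_sq_le_sq_mul_sq _ _ _
    _ ≤ 1 * ∑ k, t k ^ 2 :=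
      mul_le_mul_of_nonneg_right hu (sum_nonneg fun _ _ => sq_nonneg _)
    _ ≤ _ := by rw [one_mul]; exact h1

theorem nnetGrad_sq_le {φ : ℝ → ℝ} {u : Fin m → ℝ} (hu : ∑ k, u k ^ 2 ≤ 1) {B : ℝ}
    (hB : ∀ s, |deriv φ s| ≤ B) (x : Input d) (W D : Param d m) :
    nnetGrad φ u x W D ^ 2 ≤ B ^ 2 * (‖x‖ ^ 2 * ‖D‖ ^ 2) := by
  rw [nnetGrad_apply]
  simp only [mul_assoc]
  refine sq_sum_mul_le_of_abs_le hu x D fun k => ?_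
  rw [abs_mul]
  exact mul_le_mul_of_nonneg_right (hB _) (abs_nonneg _)

theorem abs_nnet_sub_nnet_le {φ : ℝ → ℝ} (hφ : Differentiable ℝ φ) {u : Fin m → ℝ}
    (hu : ∑ k, u k ^ 2 ≤ 1) {B : ℝ} (hB : ∀ s, |deriv φ s| ≤ B) (x : Input d)
    (V W : Param d m) :
    |nnet φ u V x - nnet φ u W x| ≤ B * ‖x‖ * ‖V - W‖ := by
  have hB0 : 0 ≤ B := (abs_nonneg _).trans (hB 0)
  refine abs_le_of_sq_le_sq ?_ (by positivity)
  rw [nnet_eq, nnet_eq, ← sum_sub_distrib, mul_pow, mul_pow, mul_assoc]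
  simp only [← mul_sub]
  refine sq_sum_mul_le_of_abs_le hu x (V - W) fun k => ?_
  rw [map_sub]
  exact Convex.norm_image_sub_le_of_norm_deriv_le (fun s _ => hφ s) (fun s _ => hB s)
    convex_univ (Set.mem_univ _) (Set.mem_univ _)

theorem abs_nnetHess_le {φ : ℝ → ℝ} {u : Fin m → ℝ} {c : ℝ} (hu : ∀ k, |u k| ≤ c) {B : ℝ}
    (hc : 0 ≤ c) (hB : ∀ s, |deriv (deriv φ) s| ≤ B) (x : Input d) (W D : Param d m) :
    |nnetHess φ u x W D D| ≤ c * B * (‖x‖ ^ 2 * ‖D‖ ^ 2) := by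
  have hB0 : 0 ≤ B := (abs_nonneg _).trans (hB 0)
  rw [nnetHess_apply]
  calc _ ≤ ∑ k, c * B * preact x k D ^ 2 := by
        refine (abs_sum_le_sum_abs _ _).trans (sum_le_sum fun k _ => ?_)
        rw [mul_assoc, ← sq, abs_mul, abs_mul, abs_of_nonneg (sq_nonneg (preact x k D))]
        exact mul_le_mul_of_nonneg_right
          (mul_le_mul (hu k) (hB _) (abs_nonneg _) hc) (sq_nonneg _)
    _ ≤ _ := by
        rw [← mul_sum]
        exact mul_le_mul_of_nonneg_left (sum_preact_sq_le x D) (by positivity)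

theorem abs_nnet_le {φ : ℝ → ℝ} {u : Fin m → ℝ} {c : ℝ} (hu : ∀ k, |u k| ≤ c) {B : ℝ}
    (hc : 0 ≤ c) (hB : ∀ s, |φ s| ≤ B) (x : Input d) (W : Param d m) :
    |nnet φ u W x| ≤ m * (c * B) := by
  rw [nnet_eq]
  calc _ ≤ ∑ _k : Fin m, c * B := by
        refine (abs_sum_le_sum_abs _ _).trans (sum_le_sum fun k _ => ?_)
        rw [abs_mul]
        exact mul_le_mul (hu k) (hB _) (abs_nonneg _) hc
    _ = _ := by simp

/-- The mean absolute residual is controlled by the root of the empirical risk. -/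
theorem mean_abs_residual_le {φ : ℝ → ℝ} {u : Fin m → ℝ} (hn : 0 < n)
    {S : Fin n → Input d × ℝ} {W : Param d m} {C : ℝ} (hC : 0 ≤ C)
    (h : empRisk φ u S W ≤ C ^ 2) :
    (1 / (n : ℝ)) * ∑ i, |nnet φ u W (S i).1 - (S i).2| ≤ Real.sqrt 2 * C := by
  have hn' : (0 : ℝ) < n := by exact_mod_cast hn
  refine (abs_le_of_sq_le_sq' ?_ (by positivity)).2
  have h2 : (∑ i, |nnet φ u W (S i).1 - (S i).2|) ^ 2 ≤
      n * ∑ i, |nnet φ u W (S i).1 - (S i).2| ^ 2 := by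
    simpa using sq_sum_le_card_mul_sum_sq (s := univ)
      (f := fun i => |nnet φ u W (S i).1 - (S i).2|)
  have h3 : (1 / (n : ℝ)) * ∑ i, |nnet φ u W (S i).1 - (S i).2| ^ 2 = 2 * empRisk φ u S W := by
    simp only [empRisk, sqLoss, sq_abs, ← mul_sum]
    ring
  calc _ = (1 / (n : ℝ)) ^ 2 * (∑ i, |nnet φ u W (S i).1 - (S i).2|) ^ 2 := mul_pow _ _ _
    _ ≤ (1 / (n : ℝ)) ^ 2 * (n * ∑ i, |nnet φ u W (S i).1 - (S i).2| ^ 2) :=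
      mul_le_mul_of_nonneg_left h2 (by positivity)
    _ = (1 / (n : ℝ)) * ∑ i, |nnet φ u W (S i).1 - (S i).2| ^ 2 := by field_simp
    _ = 2 * empRisk φ u S W := h3
    _ ≤ 2 * C ^ 2 := by linarith
    _ = _ := by rw [mul_pow, Real.sq_sqrt (by norm_num)]

theorem mean_le {n : ℕ} (hn : 0 < n) {a : Fin n → ℝ} {b : ℝ} (h : ∀ i, a i ≤ b) :
    (1 / (n : ℝ)) * ∑ i, a i ≤ b := by
  have hn' : (0 : ℝ) < n := by exact_mod_cast hn
  calc _ ≤ (1 / (n : ℝ)) * ∑ _i : Fin n, b :=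
        mul_le_mul_of_nonneg_left (sum_le_sum fun i _ => h i) (by positivity)
    _ = b := by simp; field_simp

theorem riskHess_self_le {φ : ℝ → ℝ} {Bφ Bφ' Bφ'' : ℝ} (hm : 0 < m) (hn : 0 < n)
    (hBφ : ∀ s : ℝ, |φ s| ≤ Bφ) (hBφ' : ∀ s : ℝ, |deriv φ s| ≤ Bφ')
    (hBφ'' : ∀ s : ℝ, |deriv (deriv φ) s| ≤ Bφ'')
    {u : Fin m → ℝ} (hu : ∀ k, |u k| = 1 / Real.sqrt m) (hu2 : ∑ k, u k ^ 2 ≤ 1)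
    {Cx Cy : ℝ} {S : Fin n → Input d × ℝ}
    (hx : ∀ i, ‖(S i).1‖ ≤ Cx) (hy : ∀ i, |(S i).2| ≤ Cy) (W D : Param d m) :
    riskHess φ u S W D D ≤
      Cx ^ 2 * (Bφ' ^ 2 + Bφ'' * Bφ + Bφ'' * Cy / Real.sqrt m) * ‖D‖ ^ 2 := by
  have hm' : (0 : ℝ) < m := by exact_mod_cast hm
  have hs : 0 < Real.sqrt m := Real.sqrt_pos.2 hm'
  have hB0 : 0 ≤ Bφ := (abs_nonneg _).trans (hBφ 0)
  have hB2 : 0 ≤ Bφ'' := (abs_nonneg _).trans (hBφ'' 0)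
  rw [riskHess_apply]
  refine mean_le hn fun i => ?_
  have hCy : 0 ≤ Cy := (abs_nonneg _).trans (hy i)
  have hxD : ‖(S i).1‖ ^ 2 * ‖D‖ ^ 2 ≤ Cx ^ 2 * ‖D‖ ^ 2 :=
    mul_le_mul_of_nonneg_right (pow_le_pow_left₀ (norm_nonneg _) (hx i) 2) (sq_nonneg _)
  have h1 := (nnetGrad_sq_le hu2 hBφ' (S i).1 W D).trans
    (mul_le_mul_of_nonneg_left hxD (sq_nonneg Bφ'))
  have h2 : |nnet φ u W (S i).1 - (S i).2| ≤ Real.sqrt m * Bφ + Cy := by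
    refine (abs_sub _ _).trans (add_le_add ?_ (hy i))
    refine (abs_nnet_le (fun k => (hu k).le) (by positivity) hBφ _ _).trans_eq ?_
    rw [← mul_assoc, mul_one_div, Real.div_sqrt]
  have h3 := (abs_nnetHess_le (fun k => (hu k).le) (by positivity) hBφ'' (S i).1 W D).trans
    (mul_le_mul_of_nonneg_left hxD (by positivity))
  calc _ ≤ (Real.sqrt m * Bφ + Cy) * (1 / Real.sqrt m * Bφ'' * (Cx ^ 2 * ‖D‖ ^ 2)) +
        Bφ' ^ 2 * (Cx ^ 2 * ‖D‖ ^ 2) := by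
        refine add_le_add ((le_abs_self _).trans ?_) (by rw [← sq]; exact h1)
        rw [abs_mul]
        exact mul_le_mul h2 h3 (abs_nonneg _) (by positivity)
    _ = _ := by field_simp; ring

theorem le_riskHess_self {φ : ℝ → ℝ} {Bφ' Bφ'' : ℝ} (hn : 0 < n)
    (hφ : Differentiable ℝ φ) (hBφ' : ∀ s : ℝ, |deriv φ s| ≤ Bφ')
    (hBφ'' : ∀ s : ℝ, |deriv (deriv φ) s| ≤ Bφ'')
    {u : Fin m → ℝ} (hu : ∀ k, |u k| = 1 / Real.sqrt m) (hu2 : ∑ k, u k ^ 2 ≤ 1)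
    {Cx C0 : ℝ} (hC0 : 0 ≤ C0) {S : Fin n → Input d × ℝ}
    (hx : ∀ i, ‖(S i).1‖ ≤ Cx) {Wt : Param d m} (hWt : empRisk φ u S Wt ≤ C0 ^ 2)
    (V D : Param d m) :
    -(1 / Real.sqrt m * Bφ'' * (Cx ^ 2 * ‖D‖ ^ 2) *
      (Bφ' * Cx * ‖V - Wt‖ + Real.sqrt 2 * C0)) ≤ riskHess φ u S V D D := by
  have hB1 : 0 ≤ Bφ' := (abs_nonneg _).trans (hBφ' 0)
  have hB2 : 0 ≤ Bφ'' := (abs_nonneg _).trans (hBφ'' 0)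
  set K : ℝ := 1 / Real.sqrt m * Bφ'' * (Cx ^ 2 * ‖D‖ ^ 2) with hK
  have hK0 : 0 ≤ K := by positivity
  set r : Fin n → ℝ := fun i => |nnet φ u Wt (S i).1 - (S i).2| with hr
  have hterm : ∀ i, -((nnet φ u V (S i).1 - (S i).2) * nnetHess φ u (S i).1 V D D +
      nnetGrad φ u (S i).1 V D * nnetGrad φ u (S i).1 V D) - K * r i ≤
        K * (Bφ' * Cx * ‖V - Wt‖) := fun i => by
    have hxD : ‖(S i).1‖ ^ 2 * ‖D‖ ^ 2 ≤ Cx ^ 2 * ‖D‖ ^ 2 :=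
      mul_le_mul_of_nonneg_right (pow_le_pow_left₀ (norm_nonneg _) (hx i) 2) (sq_nonneg _)
    have h3 : |nnetHess φ u (S i).1 V D D| ≤ K :=
      (abs_nnetHess_le (fun k => (hu k).le) (by positivity) hBφ'' (S i).1 V D).trans
        (mul_le_mul_of_nonneg_left hxD (by positivity))
    have h2 : |nnet φ u V (S i).1 - (S i).2| ≤ Bφ' * Cx * ‖V - Wt‖ + r i := by
      refine (abs_sub_le _ (nnet φ u Wt (S i).1) _).trans (add_le_add ?_ le_rfl)
      refine (abs_nnet_sub_nnet_le hφ hu2 hBφ' (S i).1 V Wt).trans ?_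
      have := hx i
      gcongr
    have h4 := mul_le_mul h2 h3 (abs_nonneg _) ((abs_nonneg _).trans h2)
    rw [← abs_mul] at h4
    have h5 := neg_le_of_abs_le h4
    have h6 := mul_self_nonneg (nnetGrad φ u (S i).1 V D)
    linarith
  have hmean := mean_le hn hterm
  have hres := mul_le_mul_of_nonneg_left (mean_abs_residual_le hn hC0 hWt) hK0
  rw [sum_sub_distrib, sum_neg_distrib, ← mul_sum] at hmean
  rw [riskHess_apply]
  linarith

end Bounds

/-- Smoothness and curvature of the empirical risk of a shallow network: the risk is twice
differentiable with symmetric Hessian, the largest eigenvalue of the Hessian is bounded above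
everywhere, and the smallest one is bounded below along the segment from `Wt` to `W`. -/
theorem statement1 {d m n : ℕ} (hd : 0 < d) (hm : 0 < m) (hn : 0 < n)
    (φ : ℝ → ℝ) (Bφ Bφ' Bφ'' : ℝ)
    (hφ : Differentiable ℝ φ) (hφ' : Differentiable ℝ (deriv φ))
    (hBφ : ∀ s : ℝ, |φ s| ≤ Bφ) (hBφ' : ∀ s : ℝ, |deriv φ s| ≤ Bφ')
    (hBφ'' : ∀ s : ℝ, |deriv (deriv φ) s| ≤ Bφ'')
    (u : Fin m → ℝ) (hu : ∀ k, u k = 1 / Real.sqrt m ∨ u k = -(1 / Real.sqrt m))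
    (Cx Cy C0 : ℝ) (hC0 : 0 < C0)
    (S : Fin n → Input d × ℝ)
    (hx : ∀ i, ‖(S i).1‖ ≤ Cx) (hy : ∀ i, |(S i).2| ≤ Cy)
    (W Wt : Param d m) (hWt : empRisk φ u S Wt ≤ C0 ^ 2) :
    Differentiable ℝ (empRisk φ u S : Param d m → ℝ) ∧
    Differentiable ℝ (fderiv ℝ (empRisk φ u S : Param d m → ℝ)) ∧
    (∀ V : Param d m, (hessian (empRisk φ u S) V).IsSymm) ∧
    lambdaMax (hessian (empRisk φ u S) W)
      ≤ Cx ^ 2 * (Bφ' ^ 2 + Bφ'' * Bφ + Bφ'' * Cy / Real.sqrt m) ∧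
    ∀ α ∈ Set.Icc (0 : ℝ) 1,
      -(Cx ^ 2 * Bφ'' * (Bφ' * Cx + Real.sqrt 2 * C0) / Real.sqrt m * max 1 ‖W - Wt‖)
        ≤ lambdaMin (hessian (empRisk φ u S) (Wt + α • (W - Wt))) := by
  have hm' : (0 : ℝ) < m := by exact_mod_cast hm
  have hs : 0 < Real.sqrt m := Real.sqrt_pos.2 hm'
  have hua : ∀ k, |u k| = 1 / Real.sqrt m := fun k => by
    have h0 : 0 ≤ 1 / Real.sqrt m := by positivity
    rcases hu k with h | h <;> simp only [h, abs_neg, abs_of_nonneg h0]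
  have hu2 : ∑ k, u k ^ 2 ≤ 1 := by
    have h : ∀ k, u k ^ 2 = 1 / m := fun k => by
      rw [← sq_abs, hua, div_pow, one_pow, Real.sq_sqrt hm'.le]
    simp [h, hm'.ne']
  have : Nonempty (Fin d × Fin m) := ⟨(⟨0, hd⟩, ⟨0, hm⟩)⟩
  have hsymm := isSymm_hessian_empRisk hφ hφ' u S
  have hB1 : 0 ≤ Bφ' := (abs_nonneg _).trans (hBφ' 0)
  have hB2 : 0 ≤ Bφ'' := (abs_nonneg _).trans (hBφ'' 0)
  have hCx : 0 ≤ Cx := (norm_nonneg _).trans (hx ⟨0, hn⟩)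
  have hnorm : ∀ v : Fin d × Fin m → ℝ, ∑ p, v p ^ 2 = ‖(WithLp.toLp 2 v : Param d m)‖ ^ 2 :=
    fun v => (EuclideanSpace.real_norm_sq_eq _).symm
  refine ⟨fun V => (hasFDerivAt_empRisk hφ u S V).differentiableAt, ?_, hsymm, ?_, ?_⟩
  · rw [fderiv_empRisk hφ]
    exact fun V => (hasFDerivAt_riskGrad hφ hφ' u S V).differentiableAt
  · refine lambdaMax_le (hsymm W) fun v => ?_
    rw [sum_mul_hessian_mul, fderiv_fderiv_empRisk hφ hφ', hnorm]
    exact riskHess_self_le hm hn hBφ hBφ' hBφ'' hua hu2 hx hy W _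
  · intro α hα
    refine le_lambdaMin (hsymm _) fun v => ?_
    rw [sum_mul_hessian_mul, fderiv_fderiv_empRisk hφ hφ', hnorm]
    refine le_trans ?_ (le_riskHess_self hn hφ hBφ' hBφ'' hua hu2 hC0.le hx hWt _ _)
    rw [add_sub_cancel_left, norm_smul, Real.norm_of_nonneg hα.1]
    set D : Param d m := WithLp.toLp 2 v
    have h1 : α * ‖W - Wt‖ ≤ max 1 ‖W - Wt‖ :=
      (mul_le_of_le_one_left (norm_nonneg _) hα.2).trans (le_max_right _ _)
    have h2 : Bφ' * Cx * (α * ‖W - Wt‖) + Real.sqrt 2 * C0 ≤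
        (Bφ' * Cx + Real.sqrt 2 * C0) * max 1 ‖W - Wt‖ := by
      rw [add_mul]
      exact add_le_add (mul_le_mul_of_nonneg_left h1 (by positivity))
        (le_mul_of_one_le_right (by positivity) (le_max_left _ _))
    have h3 := mul_le_mul_of_nonneg_left h2
      (show 0 ≤ 1 / Real.sqrt m * Bφ'' * (Cx ^ 2 * ‖D‖ ^ 2) by positivity)
    rw [neg_mul]
    refine neg_le_neg (h3.trans_eq ?_)
    ring
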